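/- arXiv:2203.14099 — 2 statements merged into one kernel-verified Lean document; each statement's English description precedes it below -/
import Mathlib

section
/- With the malicious-agent setup, for every fixed d ≥ 0 the one-sided limit c := lim_{λ→0⁺} (d/dλ) e(λ, d) exists and is strictly negative. Consequently, there exists ε ∈ (0,1) such that λ ↦ e(λ, d) is strictly decreasing on (0, ε); in particular, every minimizer of the continuous extension of e(·, d) to [0,1] is strictly positive. -/
open Matrix

section InitialDecrease

/-- A function that agrees to the right of `0` with a `C¹` function of negative derivative at `0`
has a negative limiting derivative and is strictly decreasing on some `(0, ε)`. -/
lemma tendsto_deriv_and_strictAntiOn_of_eventuallyEq {f g : ℝ → ℝ} (hg : ContDiffAt ℝ 1 g 0)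
    (hneg : deriv g 0 < 0) (hfg : f =ᶠ[nhdsWithin 0 (Set.Ioi 0)] g) :
    Filter.Tendsto (deriv f) (nhdsWithin 0 (Set.Ioi 0)) (nhds (deriv g 0)) ∧
      ∃ ε ∈ Set.Ioo (0 : ℝ) 1, StrictAntiOn f (Set.Ioo 0 ε) := by
  have hcont : ContinuousAt (deriv g) 0 := (hg.derivWithin (m := 0) (by norm_num)).continuousAt
  obtain ⟨u, hu, hu'⟩ := mem_nhdsGT_iff_exists_Ioo_subset.1 hfg
  have heq : ∀ x ∈ Set.Ioo (0 : ℝ) u, f =ᶠ[nhds x] g := fun x hx =>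
    Filter.mem_of_superset (isOpen_Ioo.mem_nhds hx) hu'
  have hlim : Filter.Tendsto (deriv f) (nhdsWithin 0 (Set.Ioi 0)) (nhds (deriv g 0)) := by
    refine (hcont.tendsto.mono_left nhdsWithin_le_nhds).congr' ?_
    filter_upwards [Ioo_mem_nhdsGT hu] with x hx using (heq x hx).deriv_eq.symm
  refine ⟨hlim, ?_⟩
  obtain ⟨v, hv, hv'⟩ := mem_nhdsGT_iff_exists_Ioo_subset.1 (hlim.eventually_lt_const hneg)
  have hv0 : (0 : ℝ) < v := hv
  refine ⟨min v (1 / 2), ⟨by positivity, (min_le_right _ _).trans_lt (by norm_num)⟩, ?_⟩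
  have hderiv : ∀ x ∈ Set.Ioo 0 (min v (1 / 2)), deriv f x < 0 := fun x hx =>
    hv' ⟨hx.1, hx.2.trans_le (min_le_left _ _)⟩
  refine strictAntiOn_of_deriv_neg (convex_Ioo _ _) (fun x hx => ?_) (by simpa using hderiv)
  exact (differentiableAt_of_deriv_ne_zero (hderiv x hx).ne).continuousAt.continuousWithinAt

/-- A minimizer over `[0, 1]` of a continuous function that is strictly decreasing on some
`(0, ε)` is positive. -/
lemma minimizer_pos_of_strictAntiOn {f : ℝ → ℝ} {ε x : ℝ} (hε : ε ∈ Set.Ioo (0 : ℝ) 1)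
    (hanti : StrictAntiOn f (Set.Ioo 0 ε)) (hf : ContinuousOn f (Set.Icc 0 1))
    (hx : x ∈ Set.Icc (0 : ℝ) 1) (hmin : ∀ y ∈ Set.Icc (0 : ℝ) 1, f x ≤ f y) : 0 < x := by
  obtain ⟨hε0, hε1⟩ := hε
  refine hx.1.lt_of_ne fun h => ?_
  subst h
  have hlim : Filter.Tendsto f (nhdsWithin 0 (Set.Ioi 0)) (nhds (f 0)) := by
    refine (hf 0 hx).tendsto.mono_left (nhdsWithin_le_of_mem ?_)
    exact Filter.mem_of_superset (Ioo_mem_nhdsGT one_pos) Set.Ioo_subset_Icc_self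
  have hge : f (ε / 3) ≤ f 0 := by
    refine ge_of_tendsto hlim ?_
    filter_upwards [Ioo_mem_nhdsGT (show (0 : ℝ) < ε / 3 by positivity)] with y hy
    exact (hanti ⟨hy.1, by linarith [hy.2]⟩ ⟨by positivity, by linarith⟩ hy.2).le
  have hlt : f (ε / 2) < f (ε / 3) :=
    hanti ⟨by positivity, by linarith⟩ ⟨by positivity, by linarith⟩ (by linarith)
  linarith [hmin (ε / 2) ⟨by positivity, by linarith⟩]

end InitialDecrease

section SubstochasticBlock

variable {n : Type*} [Fintype n]

/-- The Dirichlet form of a symmetric matrix with unit row sums. -/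
lemma dotProduct_one_sub_mulVec [DecidableEq n] {A : Matrix n n ℝ} (hA : A.IsSymm)
    (hrow : ∀ i, ∑ j, A i j = 1) (y : n → ℝ) :
    y ⬝ᵥ (1 - A) *ᵥ y = (∑ i, ∑ j, A i j * (y i - y j) ^ 2) / 2 := by
  have hleft : ∑ i, ∑ j, A i j * y i ^ 2 = ∑ i, y i ^ 2 :=
    Finset.sum_congr rfl fun i _ => by rw [← Finset.sum_mul, hrow, one_mul]
  have hright : ∑ i, ∑ j, A i j * y j ^ 2 = ∑ i, y i ^ 2 := by
    rw [Finset.sum_comm, ← hleft]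
    exact Finset.sum_congr rfl fun i _ => Finset.sum_congr rfl fun j _ => by rw [hA.apply]
  have hexpand : ∑ i, ∑ j, A i j * (y i - y j) ^ 2 =
      ∑ i, ∑ j, A i j * y i ^ 2 + ∑ i, ∑ j, A i j * y j ^ 2
        - 2 * ∑ i, ∑ j, y i * (A i j * y j) := by
    simp only [Finset.mul_sum, ← Finset.sum_add_distrib, ← Finset.sum_sub_distrib]
    exact Finset.sum_congr rfl fun i _ => Finset.sum_congr rfl fun j _ => by ring
  have hform : y ⬝ᵥ (1 - A) *ᵥ y = ∑ i, y i ^ 2 - ∑ i, ∑ j, y i * (A i j * y j) := by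
    rw [sub_mulVec, one_mulVec, dotProduct_sub]
    simp only [dotProduct, mulVec, Finset.mul_sum, sq]
  rw [hform, hexpand, hleft, hright]
  ring

/-- A vector that is constant along the edges of a nonnegative matrix is constant along its
walks. -/
lemma eq_of_pow_apply_pos [DecidableEq n] {A : Matrix n n ℝ} (hA : ∀ i j, 0 ≤ A i j)
    {y : n → ℝ} (hy : ∀ i j, 0 < A i j → y i = y j) (k : ℕ) :
    ∀ i j, 0 < (A ^ k) i j → y i = y j := by
  induction k with
  | zero =>
    intro i j h
    by_contra hne
    have hij : i ≠ j := fun h' => hne (h' ▸ rfl)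
    simp [hij] at h
  | succ k ih =>
    intro i j h
    rw [pow_succ, mul_apply] at h
    obtain ⟨l, -, hl⟩ := Finset.exists_lt_of_sum_lt (s := Finset.univ) (f := fun _ => (0 : ℝ))
      (by simpa using h)
    have hlj : 0 < A l j := (hA l j).lt_of_ne fun h0 => by simp [← h0] at hl
    exact (ih i l (pos_of_mul_pos_left hl hlj.le)).trans (hy l j hlj)

/-- For an irreducible symmetric stochastic matrix `A`, the matrix `1 - A₁₁` is positive definite
for every proper principal block `A₁₁`. -/
lemma posDef_one_sub_toBlocks₁₁ {m : Type*} [Fintype m] [Nonempty m] [DecidableEq m]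
    [DecidableEq n] {A : Matrix (n ⊕ m) (n ⊕ m) ℝ} (hsymm : A.IsSymm) (hnonneg : ∀ i j, 0 ≤ A i j)
    (hrow : ∀ i, ∑ j, A i j = 1) (hirr : ∀ i j, ∃ k : ℕ, 0 < (A ^ k) i j) :
    (1 - A.toBlocks₁₁).PosDef := by
  refine PosDef.of_dotProduct_mulVec_pos ?_ fun x hx => ?_
  · ext i j
    simp [toBlocks₁₁, hsymm.apply, one_apply, eq_comm]
  have hext : star x ⬝ᵥ (1 - A.toBlocks₁₁) *ᵥ x
      = Sum.elim x 0 ⬝ᵥ (1 - A) *ᵥ Sum.elim x (0 : m → ℝ) := by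
    simp [dotProduct, mulVec, toBlocks₁₁, one_apply]
  rw [hext, dotProduct_one_sub_mulVec hsymm hrow]
  set y : n ⊕ m → ℝ := Sum.elim x 0 with hy
  have hterm : ∀ i j, 0 ≤ A i j * (y i - y j) ^ 2 := fun i j =>
    mul_nonneg (hnonneg i j) (sq_nonneg _)
  have hinner : ∀ i, 0 ≤ ∑ j, A i j * (y i - y j) ^ 2 := fun i =>
    Finset.sum_nonneg fun j _ => hterm i j
  refine half_pos ((Finset.sum_nonneg fun i _ => hinner i).lt_of_ne fun h0 => hx ?_)
  have hedge : ∀ i j, 0 < A i j → y i = y j := by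
    intro i j hij
    have hi := (Finset.sum_eq_zero_iff_of_nonneg fun i _ => hinner i).1 h0.symm i
      (Finset.mem_univ i)
    have hj := (Finset.sum_eq_zero_iff_of_nonneg fun j _ => hterm i j).1 hi j (Finset.mem_univ j)
    exact sub_eq_zero.1 (pow_eq_zero_iff two_ne_zero |>.1
      ((mul_eq_zero.1 hj).resolve_left hij.ne'))
  funext i
  obtain ⟨k, hk⟩ := hirr (Sum.inl i) (Sum.inr (Classical.arbitrary m))
  simpa [hy] using eq_of_pow_apply_pos hnonneg hedge k _ _ hk

end SubstochasticBlock

section ResolventError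

variable {n m : Type*} [Fintype n] [DecidableEq n] [Fintype m] [DecidableEq m]

/-- The regular rows of the scaled resolvent of a block matrix with absorbing second block. -/
lemma fromCols_mul_smul_inv_one_sub_smul_fromBlocks (A : Matrix n n ℝ) (B : Matrix n m ℝ) {t : ℝ}
    (ht : t ≠ 0) (hA : IsUnit (1 - (1 - t) • A)) :
    fromCols (1 : Matrix n n ℝ) (0 : Matrix n m ℝ) *
        (t • (1 - (1 - t) • fromBlocks A B 0 (1 : Matrix m m ℝ))⁻¹)
      = fromCols (t • (1 - (1 - t) • A)⁻¹) ((1 - t) • ((1 - (1 - t) • A)⁻¹ * B)) := by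
  have hone : IsUnit (t • (1 : Matrix m m ℝ)) := by
    rw [isUnit_iff_isUnit_det]
    simp [ht]
  have hinv : (t • (1 : Matrix m m ℝ))⁻¹ = t⁻¹ • 1 := by
    apply inv_eq_right_inv
    simp [ht]
  have hblock : 1 - (1 - t) • fromBlocks A B 0 (1 : Matrix m m ℝ)
      = fromBlocks (1 - (1 - t) • A) (-((1 - t) • B)) 0 (t • 1) := by
    rw [← fromBlocks_one, fromBlocks_smul, sub_eq_add_neg, fromBlocks_neg, fromBlocks_add]
    congr 1
    · simp [sub_eq_add_neg]
    · simp
    · module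
  rw [hblock, inv_fromBlocks_zero₂₁_of_isUnit_iff _ _ _ (iff_of_true hA hone), hinv,
    Matrix.mul_smul, fromCols_mul_fromBlocks]
  ext i (j | j)
  · simp
  · simp [ht]

/-- The trace of a weighted Gram matrix in block form. -/
lemma trace_weighted_gram_fromCols (X : Matrix n n ℝ) (Y : Matrix n m ℝ) (d : ℝ) :
    ((1 + d • fromBlocks (0 : Matrix n n ℝ) 0 0 (1 : Matrix m m ℝ)) * (fromCols X Y)ᵀ * fromCols X Y).trace
      = (X * Xᵀ + (1 + d) • (Y * Yᵀ)).trace := by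
  have hweight : 1 + d • fromBlocks (0 : Matrix n n ℝ) 0 0 (1 : Matrix m m ℝ)
      = fromBlocks (1 : Matrix n n ℝ) 0 0 ((1 + d) • 1) := by
    rw [← fromBlocks_one, fromBlocks_smul, fromBlocks_add]
    simp [add_smul]
  rw [trace_mul_comm, hweight, transpose_fromCols, fromBlocks_mul_fromRows, fromCols_mul_fromRows]
  simp

attribute [local instance] Matrix.linftyOpNormedRing Matrix.linftyOpNormedAlgebra

lemma eventually_isUnit_one_sub_smul {A : Matrix n n ℝ} (hA : IsUnit (1 - A)) :
    ∀ᶠ t : ℝ in nhds 0, IsUnit (1 - (1 - t) • A) := by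
  have hcont : Continuous fun t : ℝ => 1 - (1 - t) • A := by fun_prop
  exact hcont.continuousAt.eventually_mem (Units.isOpen.mem_nhds (by simpa using hA))

lemma contDiffAt_inv_one_sub_smul {A : Matrix n n ℝ} (hA : IsUnit (1 - A)) :
    ContDiffAt ℝ 1 (fun t : ℝ => (1 - (1 - t) • A)⁻¹) 0 := by
  obtain ⟨u, hu⟩ := hA
  simp only [nonsing_inv_eq_ringInverse]
  refine ContDiffAt.comp (g := Ring.inverse) 0 ?_ (by fun_prop)
  simpa [hu] using contDiffAt_ringInverse ℝ u

lemma hasDerivAt_inv_one_sub_smul {A : Matrix n n ℝ} (hA : IsUnit (1 - A)) :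
    HasDerivAt (fun t : ℝ => (1 - (1 - t) • A)⁻¹) (-((1 - A)⁻¹ * A * (1 - A)⁻¹)) 0 := by
  obtain ⟨u, hu⟩ := hA
  have hlin : HasDerivAt (fun t : ℝ => 1 - (1 - t) • A) A 0 := by
    have h := (((hasDerivAt_id (0 : ℝ)).const_sub 1).smul_const A).const_sub 1
    simp only [id, neg_smul, one_smul, neg_neg] at h
    exact h
  have hinv := hasFDerivAt_ringInverse (𝕜 := ℝ) u
  rw [show (u : Matrix n n ℝ) = 1 - (1 - (0 : ℝ)) • A by simp [hu]] at hinv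
  have hcomp := hinv.comp_hasDerivAt 0 hlin
  simp only [nonsing_inv_eq_ringInverse, ← hu, Ring.inverse_unit]
  exact hcomp

/-- The error as a function of `t`, in a form that is smooth at `t = 0`. -/
noncomputable def resolventError (A C Q : Matrix n n ℝ) (d t : ℝ) : ℝ :=
  ((t • (1 - (1 - t) • A)⁻¹ - C) * (t • (1 - (1 - t) • A)⁻¹ - C) +
    (1 + d) • (((1 - t) • (1 - (1 - t) • A)⁻¹) * Q * ((1 - t) • (1 - (1 - t) • A)⁻¹))).trace

lemma contDiffAt_resolventError {A : Matrix n n ℝ} (hA : IsUnit (1 - A)) (C Q : Matrix n n ℝ)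
    (d : ℝ) : ContDiffAt ℝ 1 (resolventError A C Q d) 0 := by
  have hP := contDiffAt_inv_one_sub_smul hA
  have htr : ContDiff ℝ 1 (traceLinearMap n ℝ ℝ) :=
    (traceLinearMap n ℝ ℝ).toContinuousLinearMap.contDiff
  refine htr.contDiffAt.comp (0 : ℝ) ?_
  have hX : ContDiffAt ℝ 1 (fun t : ℝ => t • (1 - (1 - t) • A)⁻¹ - C) 0 :=
    (contDiffAt_id.smul hP).sub contDiffAt_const
  have hY : ContDiffAt ℝ 1 (fun t : ℝ => (1 - t) • (1 - (1 - t) • A)⁻¹) 0 :=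
    (contDiffAt_const.sub contDiffAt_id).smul hP
  exact (hX.mul hX).add (((hY.mul contDiffAt_const).mul hY).const_smul (1 + d))

lemma deriv_resolventError {A : Matrix n n ℝ} (hA : IsUnit (1 - A)) (C Q : Matrix n n ℝ)
    (d : ℝ) :
    deriv (resolventError A C Q d) 0
      = -2 * (C * (1 - A)⁻¹).trace
        - 2 * (1 + d) * ((1 - A)⁻¹ * (1 - A)⁻¹ * (1 - A)⁻¹ * Q).trace := by
  have hP := hasDerivAt_inv_one_sub_smul hA
  have hres : -((1 - A)⁻¹ * A * (1 - A)⁻¹) - (1 - A)⁻¹ = -((1 - A)⁻¹ * (1 - A)⁻¹) := by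
    have hdet := (isUnit_iff_isUnit_det _).1 hA
    calc _ = -((1 - A)⁻¹ * (A + (1 - A)) * (1 - A)⁻¹) := by
          rw [mul_add, add_mul, nonsing_inv_mul _ hdet, one_mul, neg_add, sub_eq_add_neg]
      _ = _ := by simp
  have hX : HasDerivAt (fun t : ℝ => t • (1 - (1 - t) • A)⁻¹ - C) (1 - A)⁻¹ 0 := by
    have h := ((hasDerivAt_id (0 : ℝ)).smul hP).sub_const C
    simp only [id, zero_smul, one_smul, sub_zero, zero_add] at h
    exact h
  have hY : HasDerivAt (fun t : ℝ => (1 - t) • (1 - (1 - t) • A)⁻¹)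
      (-((1 - A)⁻¹ * (1 - A)⁻¹)) 0 := by
    have h := ((hasDerivAt_id (0 : ℝ)).const_sub 1).smul hP
    simp only [id, one_smul, sub_zero, neg_smul, ← sub_eq_add_neg, hres] at h
    exact h
  have hF := (hX.mul hX).add (((hY.mul_const Q).mul hY).const_smul (1 + d))
  have htr := (traceLinearMap n ℝ ℝ).toContinuousLinearMap.hasFDerivAt.comp_hasDerivAt 0 hF
  refine htr.deriv.trans ?_
  change trace _ = _
  simp only [sub_zero, one_smul, zero_smul, zero_sub]
  set P := (1 - A)⁻¹
  have hcyc : (P * Q * (P * P)).trace = (P * P * P * Q).trace := by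
    rw [trace_mul_comm]
    simp only [mul_assoc]
  have hcyc' : (P * P * Q * P).trace = (P * P * P * Q).trace := by
    rw [trace_mul_comm]
    simp only [mul_assoc]
  have hcomm : (P * C).trace = (C * P).trace := trace_mul_comm _ _
  simp only [trace_add, trace_smul, mul_neg, neg_mul, trace_neg, hcyc, hcyc', hcomm, smul_eq_mul]
  ring

end ResolventError

/-- In the malicious-agent setup, for every fixed `d ≥ 0` the one-sided
limit `c = lim_{λ→0⁺} (d/dλ) e(λ, d)` exists and is strictly negative; consequently
`λ ↦ e(λ, d)` is strictly decreasing on some `(0, ε)`, and every minimizer over `[0,1]`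
of the continuous extension of `e(·, d)` to `[0,1]` is strictly positive. -/
theorem optimal_lambda_positive
    (R M : ℕ) (hR : 2 ≤ R) (hM : 1 ≤ M)
    (W0 : Matrix (Fin R ⊕ Fin M) (Fin R ⊕ Fin M) ℝ)
    (hW0symm : W0.IsSymm)
    (hW0nonneg : ∀ i j, 0 ≤ W0 i j)
    (hW0row : ∀ i, ∑ j, W0 i j = 1)
    (hW0diag : ∀ i, W0 i i = 0)
    (hW0irr : ∀ i j, ∃ k : ℕ, 0 < (W0 ^ k) i j)
    (W : Matrix (Fin R ⊕ Fin M) (Fin R ⊕ Fin M) ℝ)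
    (hW : W = Matrix.fromBlocks W0.toBlocks₁₁ W0.toBlocks₁₂ 0 1)
    (hW12 : W0.toBlocks₁₂ ≠ 0)
    (L : ℝ → Matrix (Fin R ⊕ Fin M) (Fin R ⊕ Fin M) ℝ)
    (hL : ∀ lam : ℝ, L lam = lam • (1 - (1 - lam) • W)⁻¹)
    (S : Matrix (Fin R) (Fin R ⊕ Fin M) ℝ)
    (hS : S = Matrix.of fun i j => if j = Sum.inl i then 1 else 0)
    (CR : Matrix (Fin R) (Fin R) ℝ)
    (hCR : CR = Matrix.of fun _ _ => (R : ℝ)⁻¹)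
    (V : Matrix (Fin R ⊕ Fin M) (Fin R ⊕ Fin M) ℝ)
    (hV : V = Matrix.fromBlocks 0 0 0 1)
    (E : ℝ → Matrix (Fin R) (Fin R ⊕ Fin M) ℝ)
    (hE : ∀ lam : ℝ, E lam = S * L lam - CR * S)
    (e : ℝ → ℝ → ℝ)
    (he : ∀ (lam d : ℝ), e lam d = ((1 + d • V) * (E lam)ᵀ * E lam).trace)
    (d : ℝ) (hd : 0 ≤ d) :
    (∃ c : ℝ, c < 0 ∧
        Filter.Tendsto (fun lam => deriv (fun t => e t d) lam)
          (nhdsWithin 0 (Set.Ioi 0)) (nhds c))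
    ∧ (∃ ε ∈ Set.Ioo (0 : ℝ) 1,
        StrictAntiOn (fun lam => e lam d) (Set.Ioo 0 ε))
    ∧ ∀ ebar : ℝ → ℝ, ContinuousOn ebar (Set.Icc 0 1) →
        (∀ lam ∈ Set.Ioc (0 : ℝ) 1, ebar lam = e lam d) →
        ∀ lamStar ∈ Set.Icc (0 : ℝ) 1,
          (∀ lam ∈ Set.Icc (0 : ℝ) 1, ebar lamStar ≤ ebar lam) → 0 < lamStar := by
  have : Nonempty (Fin M) := ⟨⟨0, hM⟩⟩
  have hpos := posDef_one_sub_toBlocks₁₁ hW0symm hW0nonneg hW0row hW0irr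
  have hAsymm : W0.toBlocks₁₁ᵀ = W0.toBlocks₁₁ := by
    ext i j
    exact hW0symm.apply _ _
  set A := W0.toBlocks₁₁
  set B := W0.toBlocks₁₂
  have hSblock : S = fromCols (1 : Matrix (Fin R) (Fin R) ℝ) (0 : Matrix (Fin R) (Fin M) ℝ) := by
    ext i (j | j) <;> simp [hS, one_apply, eq_comm (a := j)]
  have hCRsymm : CRᵀ = CR := by
    ext i j
    simp [hCR]
  have herr : (fun t => e t d) =ᶠ[nhdsWithin 0 (Set.Ioi 0)] resolventError A CR (B * Bᵀ) d := by
    filter_upwards [self_mem_nhdsWithin,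
      nhdsWithin_le_nhds (eventually_isUnit_one_sub_smul hpos.isUnit)] with t ht hunit
    have hEblock : E t = fromCols (t • (1 - (1 - t) • A)⁻¹ - CR)
        ((1 - t) • ((1 - (1 - t) • A)⁻¹ * B)) := by
      rw [hE, hL, hW, hSblock, mul_fromCols,
        fromCols_mul_smul_inv_one_sub_smul_fromBlocks A B (ne_of_gt ht) hunit]
      ext i (j | j) <;> simp
    have hPsymm : ((1 - (1 - t) • A)⁻¹)ᵀ = (1 - (1 - t) • A)⁻¹ := by
      rw [transpose_nonsing_inv, transpose_sub, transpose_smul, transpose_one, hAsymm]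
    simp only [he, hV]
    rw [hEblock, trace_weighted_gram_fromCols, resolventError]
    simp [transpose_mul, hPsymm, hCRsymm, Matrix.mul_assoc]
  have hneg : deriv (resolventError A CR (B * Bᵀ) d) 0 < 0 := by
    rw [deriv_resolventError hpos.isUnit]
    have hR0 : (0 : ℝ) < R := by exact_mod_cast (by omega : 0 < R)
    have : Nonempty (Fin R) := ⟨⟨0, by omega⟩⟩
    have hPpos := hpos.inv
    have hPsymm : ((1 - A)⁻¹)ᵀ = (1 - A)⁻¹ := by
      rw [transpose_nonsing_inv, transpose_sub, transpose_one, hAsymm]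
    have hcons : 0 < (CR * (1 - A)⁻¹).trace := by
      have h := hPpos.dotProduct_mulVec_pos (x := 1) one_ne_zero
      have heq : (CR * (1 - A)⁻¹).trace = (R : ℝ)⁻¹ * (star 1 ⬝ᵥ (1 - A)⁻¹ *ᵥ 1) := by
        simp only [trace, diag, mul_apply, hCR, of_apply, dotProduct, mulVec, Pi.star_apply,
          Pi.one_apply, star_one, one_mul, mul_one, ← Finset.mul_sum]
        rw [Finset.sum_comm]
      rw [heq]
      positivity
    have hmal : 0 ≤ ((1 - A)⁻¹ * (1 - A)⁻¹ * (1 - A)⁻¹ * (B * Bᵀ)).trace := by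
      have h := (hPpos.posSemidef.conjTranspose_mul_mul_same ((1 - A)⁻¹ * B)).trace_nonneg
      rw [conjTranspose_eq_transpose_of_trivial, transpose_mul, hPsymm, trace_mul_comm] at h
      rw [← Matrix.mul_assoc, trace_mul_comm]
      rw [trace_mul_comm] at h
      simpa only [Matrix.mul_assoc] using h
    nlinarith [mul_nonneg (by linarith : (0 : ℝ) ≤ 1 + d) hmal]
  obtain ⟨hlim, ε, hε, hanti⟩ := tendsto_deriv_and_strictAntiOn_of_eventuallyEq
    (contDiffAt_resolventError hpos.isUnit CR (B * Bᵀ) d) hneg herr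
  refine ⟨⟨_, hneg, hlim⟩, ⟨ε, hε, hanti⟩, fun ebar hcont hebar lamStar hmem hmin => ?_⟩
  refine minimizer_pos_of_strictAntiOn hε (hanti.congr fun t ht => ?_) hcont hmem hmin
  exact (hebar t ⟨ht.1, (ht.2.trans hε.2).le⟩).symm
end

section
/- With the malicious-agent setup, for every fixed d ≥ 0 the limit ē(0) := lim_{λ→0⁺} e(λ, d) exists, the extension ē : [0,1] → ℝ defined by ē(λ) = e(λ, d) for λ ∈ (0,1] and ē(0) as above is continuous, ē attains a global minimum on [0,1], and every global minimizer λ* of ē satisfies 0 < λ* < 1. That is, the optimal Friedkin–Johnsen parameter is neither full collaboration (λ = 0) nor full competition (λ = 1). -/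
open Matrix

/-- Minimum principle for a killed random walk: a function that is superharmonic off a nonempty
set of absorbing states and vanishes there is nonnegative. -/
lemma nonneg_of_superharmonic {n m : Type*} [Fintype n] [Fintype m] [DecidableEq n]
    [DecidableEq m] [Nonempty m] {P : Matrix (n ⊕ m) (n ⊕ m) ℝ} (hP : ∀ i j, 0 ≤ P i j)
    (hrow : ∀ i, ∑ j, P i j = 1) (hirr : ∀ i j, ∃ k : ℕ, 0 < (P ^ k) i j)
    {t : ℝ} (ht0 : 0 ≤ t) (ht1 : t ≤ 1) {x : n → ℝ}
    (hx : ∀ i, 0 ≤ ((1 - t • P.toBlocks₁₁) *ᵥ x) i) (i : n) : 0 ≤ x i := by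
  by_contra! hneg
  set y : n ⊕ m → ℝ := Sum.elim x 0 with hy
  obtain ⟨i₀, hi₀⟩ := @Finite.exists_min (n ⊕ m) ℝ _ ⟨Sum.inl i⟩ _ y
  have hmneg : y i₀ < 0 := (hi₀ (Sum.inl i)).trans_lt (by simpa [hy] using hneg)
  have step : ∀ a b, y a = y i₀ → 0 < P a b → y b = y i₀ := by
    intro a b ha hab
    have hle : t * ∑ j, P a j * y j ≤ y i₀ := by
      rcases a with a | a
      · have h := hx a
        rw [Matrix.sub_mulVec, Matrix.smul_mulVec, Matrix.one_mulVec] at h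
        have hsum : ∑ j, P (Sum.inl a) j * y j = (P.toBlocks₁₁ *ᵥ x) a := by
          simp [hy, Matrix.mulVec, dotProduct, Matrix.toBlocks₁₁]
        have hax : x a = y i₀ := by simpa [hy] using ha
        simp only [Pi.sub_apply, Pi.smul_apply, smul_eq_mul] at h
        rw [hsum]
        linarith
      · simp only [hy, Sum.elim_inr, Pi.zero_apply] at ha
        linarith [hmneg, ha]
    have hge : ∑ j, P a j * (y j - y i₀) = ∑ j, P a j * y j - y i₀ := by
      simp only [mul_sub, Finset.sum_sub_distrib, ← Finset.sum_mul, hrow, one_mul]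
    have hterm : ∀ j ∈ Finset.univ, 0 ≤ P a j * (y j - y i₀) :=
      fun j _ => mul_nonneg (hP a j) (sub_nonneg.2 (hi₀ j))
    have hzero : ∑ j, P a j * (y j - y i₀) = 0 := by
      refine le_antisymm ?_ (Finset.sum_nonneg hterm)
      rw [hge]
      set s := ∑ j, P a j * y j
      have hs : s < 0 := by
        by_contra! hs
        nlinarith [mul_nonneg ht0 hs]
      nlinarith
    have hb := (Finset.sum_eq_zero_iff_of_nonneg hterm).1 hzero b (Finset.mem_univ b)
    rcases mul_eq_zero.1 hb with h | h <;> linarith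
  have reach : ∀ (k : ℕ) (b : n ⊕ m), 0 < (P ^ k) i₀ b → y b = y i₀ := by
    intro k
    induction k with
    | zero =>
      intro b hb
      by_cases h : i₀ = b
      · rw [h]
      · simp [h] at hb
    | succ k ih =>
      intro b hb
      rw [pow_succ, Matrix.mul_apply] at hb
      obtain ⟨c, -, hc⟩ := Finset.exists_lt_of_sum_lt (s := Finset.univ)
        (f := fun _ => (0 : ℝ))
        (g := fun j => (P ^ k) i₀ j * P j b) (by rwa [Finset.sum_const_zero])
      rcases (hP c b).eq_or_lt with h | h
      · simp [← h] at hc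
      · exact step c b (ih c (pos_of_mul_pos_left hc h.le)) h
  obtain ⟨k, hk⟩ := hirr i₀ (Sum.inr (Classical.arbitrary m))
  have := reach k _ hk
  simp only [hy, Sum.elim_inr, Pi.zero_apply] at this
  exact hmneg.ne this.symm

/-- A square matrix satisfying the minimum principle is invertible. -/
lemma isUnit_det_of_minimum_principle {n : Type*} [Fintype n] [DecidableEq n]
    {K : Matrix n n ℝ} (hK : ∀ x : n → ℝ, (∀ i, 0 ≤ (K *ᵥ x) i) → ∀ i, 0 ≤ x i) :
    IsUnit K.det := by
  rw [isUnit_iff_ne_zero]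
  intro h
  obtain ⟨x, hx0, hx⟩ := Matrix.exists_mulVec_eq_zero_iff.2 h
  refine hx0 (funext fun i => le_antisymm ?_ (hK x (fun i => by simp [hx]) i))
  have := hK (-x) (fun i => by simp [Matrix.mulVec_neg, hx]) i
  simpa using this

/-- The inverse of a matrix satisfying the minimum principle is entrywise nonnegative. -/
lemma inv_nonneg_of_minimum_principle {n : Type*} [Fintype n] [DecidableEq n]
    {K : Matrix n n ℝ} (hK : ∀ x : n → ℝ, (∀ i, 0 ≤ (K *ᵥ x) i) → ∀ i, 0 ≤ x i) (i j : n) :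
    0 ≤ K⁻¹ i j := by
  refine hK (fun i => K⁻¹ i j) (fun i => ?_) i
  have h : (K *ᵥ fun i => K⁻¹ i j) i = (K * K⁻¹) i j := rfl
  rw [h, Matrix.mul_nonsing_inv _ (isUnit_det_of_minimum_principle hK), Matrix.one_apply]
  split_ifs <;> norm_num

lemma matrix_mul_apply_nonneg {l n m : Type*} [Fintype n] {X : Matrix l n ℝ} {Y : Matrix n m ℝ}
    (hX : ∀ i j, 0 ≤ X i j) (hY : ∀ i j, 0 ≤ Y i j) (i : l) (k : m) : 0 ≤ (X * Y) i k := by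
  rw [Matrix.mul_apply]
  exact Finset.sum_nonneg fun j _ => mul_nonneg (hX i j) (hY j k)

lemma continuousOn_sum_sum {n m : Type*} [Fintype n] [Fintype m] {s : Set ℝ}
    {F : n → m → ℝ → ℝ} (hF : ∀ i j, ContinuousOn (F i j) s) :
    ContinuousOn (fun t => ∑ i, ∑ j, F i j t) s :=
  continuousOn_finsetSum _ fun i _ => continuousOn_finsetSum _ fun j _ => hF i j

/-- The resolvent `(1 - (1 - λ) A)⁻¹`. -/
noncomputable def resolventFJ {n : Type*} [Fintype n] [DecidableEq n] (A : Matrix n n ℝ)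
    (lam : ℝ) : Matrix n n ℝ := (1 - (1 - lam) • A)⁻¹

/-- The consensus error written through the regular block of the weight matrix; it makes sense
at `λ = 0` too. -/
noncomputable def consensusError {n m : Type*} [Fintype n] [DecidableEq n] [Fintype m]
    (A : Matrix n n ℝ) (B : Matrix n m ℝ) (c d lam : ℝ) : ℝ :=
  ∑ i, ∑ j, (lam * resolventFJ A lam i j - c) ^ 2 +
    (1 + d) * ∑ i, ∑ k, ((1 - lam) * (resolventFJ A lam * B) i k) ^ 2

section Resolvent

variable {n m : Type*} [Fintype n] [DecidableEq n] {A : Matrix n n ℝ} {B : Matrix n m ℝ}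

lemma continuousOn_resolventFJ
    (hdet : ∀ lam ∈ Set.Icc (0 : ℝ) 1, IsUnit (1 - (1 - lam) • A).det) :
    ContinuousOn (resolventFJ A) (Set.Icc 0 1) := by
  have hK : Continuous fun lam : ℝ => 1 - (1 - lam) • A := by fun_prop
  have heq : resolventFJ A =
      fun lam => (1 - (1 - lam) • A).det⁻¹ • (1 - (1 - lam) • A).adjugate := by
    ext1 lam
    rw [resolventFJ, Matrix.inv_def, Ring.inverse_eq_inv']
  rw [heq]
  exact (hK.matrix_det.continuousOn.inv₀ fun lam h => (hdet lam h).ne_zero).smul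
    hK.matrix_adjugate.continuousOn

lemma continuousOn_resolventFJ_apply
    (hdet : ∀ lam ∈ Set.Icc (0 : ℝ) 1, IsUnit (1 - (1 - lam) • A).det) (i j : n) :
    ContinuousOn (fun lam => resolventFJ A lam i j) (Set.Icc 0 1) :=
  ((continuous_id.matrix_elem i j).comp_continuousOn (continuousOn_resolventFJ hdet))

lemma continuousOn_resolventFJ_mul_apply
    (hdet : ∀ lam ∈ Set.Icc (0 : ℝ) 1, IsUnit (1 - (1 - lam) • A).det) (i : n) (k : m) :
    ContinuousOn (fun lam => (resolventFJ A lam * B) i k) (Set.Icc 0 1) := by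
  simp only [Matrix.mul_apply]
  exact continuousOn_finsetSum _ fun j _ =>
    (continuousOn_resolventFJ_apply hdet i j).mul continuousOn_const

lemma continuousOn_mul_resolventFJ_apply
    (hdet : ∀ lam ∈ Set.Icc (0 : ℝ) 1, IsUnit (1 - (1 - lam) • A).det) (i j : n) :
    ContinuousOn (fun lam => (A * resolventFJ A lam) i j) (Set.Icc 0 1) := by
  simp only [Matrix.mul_apply]
  exact continuousOn_finsetSum _ fun k _ =>
    continuousOn_const.mul (continuousOn_resolventFJ_apply hdet k j)

lemma continuousOn_consensusError [Fintype m]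
    (hdet : ∀ lam ∈ Set.Icc (0 : ℝ) 1, IsUnit (1 - (1 - lam) • A).det) (c d : ℝ) :
    ContinuousOn (consensusError A B c d) (Set.Icc 0 1) := by
  have h₁ := continuousOn_resolventFJ_apply hdet
  have h₂ := continuousOn_resolventFJ_mul_apply (B := B) hdet
  exact (continuousOn_sum_sum fun i j =>
      ((continuousOn_id.mul (h₁ i j)).sub continuousOn_const).pow 2).add
    (continuousOn_const.mul (continuousOn_sum_sum fun i k =>
      ((continuousOn_const.sub continuousOn_id).mul (h₂ i k)).pow 2))

lemma resolventFJ_eq_one_add {lam : ℝ} (hdet : IsUnit (1 - (1 - lam) • A).det) :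
    resolventFJ A lam = 1 + (1 - lam) • (A * resolventFJ A lam) := by
  have h := Matrix.mul_nonsing_inv _ hdet
  rw [Matrix.sub_mul, Matrix.one_mul, Matrix.smul_mul] at h
  exact sub_eq_iff_eq_add.1 h

lemma resolventFJ_sub_resolventFJ_zero {lam : ℝ} (hdet : IsUnit (1 - (1 - lam) • A).det)
    (hdet₀ : IsUnit (1 - (1 - (0 : ℝ)) • A).det) :
    resolventFJ A 0 - resolventFJ A lam = lam • (resolventFJ A lam * A * resolventFJ A 0) := by
  have h₁ : resolventFJ A lam * (1 - (1 - lam) • A) = 1 := Matrix.nonsing_inv_mul _ hdet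
  have h₂ : (1 - (1 - (0 : ℝ)) • A) * resolventFJ A 0 = 1 := Matrix.mul_nonsing_inv _ hdet₀
  calc resolventFJ A 0 - resolventFJ A lam
      = (resolventFJ A lam * (1 - (1 - lam) • A)) * resolventFJ A 0
        - resolventFJ A lam * ((1 - (1 - (0 : ℝ)) • A) * resolventFJ A 0) := by
        rw [h₁, h₂, Matrix.one_mul, Matrix.mul_one]
    _ = resolventFJ A lam * ((1 - (1 - lam) • A) - (1 - (1 - (0 : ℝ)) • A))
          * resolventFJ A 0 := by
        simp only [Matrix.mul_sub, Matrix.sub_mul, Matrix.mul_assoc]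
    _ = _ := by
        have : (1 - (1 - lam) • A) - (1 - (1 - (0 : ℝ)) • A) = lam • A := by module
        rw [this, Matrix.mul_smul, Matrix.smul_mul]

lemma one_le_resolventFJ_apply_self {lam : ℝ} (hlam : lam ≤ 1) (hA : ∀ i j, 0 ≤ A i j)
    (hdet : IsUnit (1 - (1 - lam) • A).det) (hG : ∀ i j, 0 ≤ resolventFJ A lam i j) (i : n) :
    1 ≤ resolventFJ A lam i i := by
  rw [resolventFJ_eq_one_add hdet, Matrix.add_apply, Matrix.one_apply_eq, Matrix.smul_apply,
    Matrix.mul_apply, smul_eq_mul]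
  have : 0 ≤ (1 - lam) * ∑ j, A i j * resolventFJ A lam j i :=
    mul_nonneg (by linarith) (Finset.sum_nonneg fun j _ => mul_nonneg (hA i j) (hG j i))
  linarith

/-- First-order upper bound of the consensus error at `λ = 0`. -/
lemma consensusError_le_left [Fintype m] {c d lam : ℝ} (hc : c * Fintype.card n = 1) (hd : 0 ≤ d)
    (hlam : lam ∈ Set.Icc (0 : ℝ) 1) (hA : ∀ i j, 0 ≤ A i j) (hB : ∀ i k, 0 ≤ B i k)
    (hdet : ∀ lam ∈ Set.Icc (0 : ℝ) 1, IsUnit (1 - (1 - lam) • A).det)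
    (hG : ∀ lam ∈ Set.Icc (0 : ℝ) 1, ∀ i j, 0 ≤ resolventFJ A lam i j) :
    consensusError A B c d lam ≤ consensusError A B c d 0 +
      lam * (lam * ∑ i, ∑ j, resolventFJ A lam i j ^ 2 - 2) := by
  have h0 : (0 : ℝ) ∈ Set.Icc (0 : ℝ) 1 := by simp
  have hc0 : 0 ≤ c := by
    by_contra! h
    nlinarith [(Nat.cast_nonneg (Fintype.card n) : (0 : ℝ) ≤ _)]
  have hsum : 1 ≤ c * ∑ i, ∑ j, resolventFJ A lam i j := by
    rw [← hc]
    refine mul_le_mul_of_nonneg_left ?_ hc0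
    calc (Fintype.card n : ℝ) = ∑ _i : n, (1 : ℝ) := by simp
      _ ≤ _ := Finset.sum_le_sum fun i _ =>
        (one_le_resolventFJ_apply_self hlam.2 hA (hdet lam hlam) (hG lam hlam) i).trans
          (Finset.single_le_sum (fun j _ => hG lam hlam i j) (Finset.mem_univ i))
  have hH : ∑ i, ∑ k, ((1 - lam) * (resolventFJ A lam * B) i k) ^ 2 ≤
      ∑ i, ∑ k, ((1 - 0) * (resolventFJ A 0 * B) i k) ^ 2 := by
    refine Finset.sum_le_sum fun i _ => Finset.sum_le_sum fun k _ => ?_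
    have hpos := matrix_mul_apply_nonneg (hG lam hlam) hB i k
    have hdiff : 0 ≤ (resolventFJ A 0 * B) i k - (resolventFJ A lam * B) i k := by
      rw [← Matrix.sub_apply, ← Matrix.sub_mul,
        resolventFJ_sub_resolventFJ_zero (hdet lam hlam) (hdet 0 h0), Matrix.smul_mul,
        Matrix.smul_apply]
      exact mul_nonneg hlam.1 (matrix_mul_apply_nonneg
        (matrix_mul_apply_nonneg (matrix_mul_apply_nonneg (hG lam hlam) hA) (hG 0 h0)) hB i k)
    refine pow_le_pow_left₀ (mul_nonneg (by linarith [hlam.2]) hpos) ?_ 2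
    nlinarith [hlam.1, mul_nonneg hlam.1 hpos]
  have hF : ∑ i, ∑ j, (lam * resolventFJ A lam i j - c) ^ 2 =
      ∑ i, ∑ j, (0 * resolventFJ A 0 i j - c) ^ 2 +
        (lam ^ 2 * ∑ i, ∑ j, resolventFJ A lam i j ^ 2
          - 2 * lam * (c * ∑ i, ∑ j, resolventFJ A lam i j)) := by
    simp only [Finset.mul_sum, ← Finset.sum_sub_distrib, ← Finset.sum_add_distrib]
    exact Finset.sum_congr rfl fun i _ => Finset.sum_congr rfl fun j _ => by ring
  unfold consensusError
  rw [hF]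
  nlinarith [mul_le_mul_of_nonneg_left hH (by linarith : 0 ≤ 1 + d),
    mul_le_mul_of_nonneg_left hsum hlam.1]

/-- First-order expansion of the consensus error at `λ = 1`. -/
lemma consensusError_eq_right [Fintype m] {c d lam : ℝ} (hdet : IsUnit (1 - (1 - lam) • A).det) :
    consensusError A B c d lam = consensusError A B c d 1 + (1 - lam) *
      (2 * ∑ i, ∑ j, ((1 : Matrix n n ℝ) i j - c) *
          (lam * (A * resolventFJ A lam) i j - (1 : Matrix n n ℝ) i j) +
        (1 - lam) * (∑ i, ∑ j, (lam * (A * resolventFJ A lam) i j - (1 : Matrix n n ℝ) i j) ^ 2 +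
          (1 + d) * ∑ i, ∑ k, (resolventFJ A lam * B) i k ^ 2)) := by
  have hone : resolventFJ A 1 = 1 := by simp [resolventFJ]
  have hentry : ∀ i j, resolventFJ A lam i j =
      (1 : Matrix n n ℝ) i j + (1 - lam) * (A * resolventFJ A lam) i j := fun i j => by
    conv_lhs => rw [resolventFJ_eq_one_add hdet]
    simp
  have hF : ∑ i, ∑ j, (lam * resolventFJ A lam i j - c) ^ 2 =
      ∑ i, ∑ j, ((1 : Matrix n n ℝ) i j - c) ^ 2 +
        ((1 - lam) * (2 * ∑ i, ∑ j, ((1 : Matrix n n ℝ) i j - c) *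
          (lam * (A * resolventFJ A lam) i j - (1 : Matrix n n ℝ) i j)) +
        (1 - lam) ^ 2 *
          ∑ i, ∑ j, (lam * (A * resolventFJ A lam) i j - (1 : Matrix n n ℝ) i j) ^ 2) := by
    simp only [Finset.mul_sum, ← Finset.sum_add_distrib]
    refine Finset.sum_congr rfl fun i _ => Finset.sum_congr rfl fun j _ => ?_
    rw [hentry i j]
    ring
  have hH : ∑ i, ∑ k, ((1 - lam) * (resolventFJ A lam * B) i k) ^ 2 =
      (1 - lam) ^ 2 * ∑ i, ∑ k, (resolventFJ A lam * B) i k ^ 2 := by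
    simp only [Finset.mul_sum, mul_pow]
  unfold consensusError
  rw [hF, hH, hone]
  simp
  ring

end Resolvent

lemma exists_mem_Ioc_neg_of_continuousOn {g : ℝ → ℝ} (hg : ContinuousOn g (Set.Icc 0 1))
    (h0 : g 0 < 0) : ∃ t ∈ Set.Ioc (0 : ℝ) 1, g t < 0 := by
  have h : Filter.Tendsto g (nhdsWithin 0 (Set.Ioc 0 1)) (nhds (g 0)) :=
    (hg 0 (by simp)).mono_left (nhdsWithin_mono _ Set.Ioc_subset_Icc_self)
  rw [nhdsWithin_Ioc_eq_nhdsGT one_pos] at h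
  obtain ⟨t, ht, hlt⟩ := ((h.eventually_lt_const h0).and
    (Ioc_mem_nhdsGT (one_pos : (0 : ℝ) < 1))).exists
  exact ⟨t, hlt, ht⟩

lemma exists_mem_Ico_neg_of_continuousOn {g : ℝ → ℝ} (hg : ContinuousOn g (Set.Icc 0 1))
    (h1 : g 1 < 0) : ∃ t ∈ Set.Ico (0 : ℝ) 1, g t < 0 := by
  obtain ⟨t, ht, hlt⟩ := exists_mem_Ioc_neg_of_continuousOn (g := fun t => g (1 - t))
    (hg.comp (by fun_prop) fun t ht => ⟨by linarith [ht.2], by linarith [ht.1]⟩) (by simpa using h1)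
  exact ⟨1 - t, ⟨by linarith [ht.2], by linarith [ht.1]⟩, hlt⟩

/-- The linear coefficient of the consensus error at `λ = 1` has the expected sign. -/
lemma sum_one_sub_mul_sub_one_neg {n : Type*} [Fintype n] [DecidableEq n] {A : Matrix n n ℝ}
    {c : ℝ} (hc : c * Fintype.card n = 1) (hn : 2 ≤ Fintype.card n) (hA : ∀ i j, 0 ≤ A i j)
    (hdiag : ∀ i, A i i = 0) :
    ∑ i, ∑ j, ((1 : Matrix n n ℝ) i j - c) * (A i j - (1 : Matrix n n ℝ) i j) < 0 := by
  have hn' : (2 : ℝ) ≤ Fintype.card n := by exact_mod_cast hn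
  have hc0 : 0 ≤ c := by
    by_contra! h
    nlinarith
  have hrow : ∀ i, ∑ j, ((1 : Matrix n n ℝ) i j - c) * (A i j - (1 : Matrix n n ℝ) i j) =
      c - 1 - c * ∑ j, A i j := fun i => by
    simp [sub_mul, mul_sub, Finset.sum_sub_distrib, Matrix.one_apply, hdiag, ← Finset.mul_sum]
    ring
  simp only [hrow]
  have : ∀ i ∈ Finset.univ, c - 1 - c * ∑ j, A i j ≤ c - 1 := fun i _ => by
    have := mul_nonneg hc0 (Finset.sum_nonneg fun j (_ : j ∈ Finset.univ) => hA i j)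
    linarith
  refine (Finset.sum_le_sum this).trans_lt ?_
  simp only [Finset.sum_const, Finset.card_univ, nsmul_eq_mul]
  nlinarith

lemma exists_consensusError_lt_left {n m : Type*} [Fintype n] [DecidableEq n] [Fintype m]
    {A : Matrix n n ℝ} {B : Matrix n m ℝ} {c d : ℝ} (hc : c * Fintype.card n = 1) (hd : 0 ≤ d)
    (hA : ∀ i j, 0 ≤ A i j) (hB : ∀ i k, 0 ≤ B i k)
    (hdet : ∀ lam ∈ Set.Icc (0 : ℝ) 1, IsUnit (1 - (1 - lam) • A).det)
    (hG : ∀ lam ∈ Set.Icc (0 : ℝ) 1, ∀ i j, 0 ≤ resolventFJ A lam i j) :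
    ∃ t ∈ Set.Icc (0 : ℝ) 1, consensusError A B c d t < consensusError A B c d 0 := by
  have hQ : ContinuousOn (fun lam => ∑ i, ∑ j, resolventFJ A lam i j ^ 2) (Set.Icc 0 1) :=
    continuousOn_sum_sum fun i j => (continuousOn_resolventFJ_apply hdet i j).pow 2
  obtain ⟨t, ht, hneg⟩ := exists_mem_Ioc_neg_of_continuousOn
    ((continuousOn_id.mul hQ).sub (continuousOn_const (c := 2))) (by simp)
  have htI : t ∈ Set.Icc (0 : ℝ) 1 := ⟨ht.1.le, ht.2⟩
  exact ⟨t, htI, (consensusError_le_left hc hd htI hA hB hdet hG).trans_lt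
    (add_lt_of_neg_right _ (mul_neg_of_pos_of_neg ht.1 hneg))⟩

lemma exists_consensusError_lt_right {n m : Type*} [Fintype n] [DecidableEq n] [Fintype m]
    {A : Matrix n n ℝ} {B : Matrix n m ℝ} {c d : ℝ} (hc : c * Fintype.card n = 1)
    (hn : 2 ≤ Fintype.card n) (hA : ∀ i j, 0 ≤ A i j) (hdiag : ∀ i, A i i = 0)
    (hdet : ∀ lam ∈ Set.Icc (0 : ℝ) 1, IsUnit (1 - (1 - lam) • A).det) :
    ∃ t ∈ Set.Icc (0 : ℝ) 1, consensusError A B c d t < consensusError A B c d 1 := by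
  have hX : ∀ i j, ContinuousOn (fun lam => lam * (A * resolventFJ A lam) i j -
      (1 : Matrix n n ℝ) i j) (Set.Icc 0 1) := fun i j =>
    (continuousOn_id.mul (continuousOn_mul_resolventFJ_apply hdet i j)).sub continuousOn_const
  have hlin : ContinuousOn (fun lam => ∑ i, ∑ j, ((1 : Matrix n n ℝ) i j - c) *
      (lam * (A * resolventFJ A lam) i j - (1 : Matrix n n ℝ) i j)) (Set.Icc 0 1) :=
    continuousOn_sum_sum fun i j => continuousOn_const.mul (hX i j)
  have hsq : ContinuousOn (fun lam => ∑ i, ∑ j,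
      (lam * (A * resolventFJ A lam) i j - (1 : Matrix n n ℝ) i j) ^ 2) (Set.Icc 0 1) :=
    continuousOn_sum_sum fun i j => (hX i j).pow 2
  have hmal : ContinuousOn (fun lam => ∑ i, ∑ k, (resolventFJ A lam * B) i k ^ 2)
      (Set.Icc 0 1) :=
    continuousOn_sum_sum fun i k => (continuousOn_resolventFJ_mul_apply hdet i k).pow 2
  obtain ⟨t, ht, hneg⟩ := exists_mem_Ico_neg_of_continuousOn
    (((continuousOn_const (c := 2)).mul hlin).add
      (((continuousOn_const (c := 1)).sub continuousOn_id).mul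
        (hsq.add ((continuousOn_const (c := 1 + d)).mul hmal)))) (by
      have hone : resolventFJ A 1 = 1 := by simp [resolventFJ]
      have := sum_one_sub_mul_sub_one_neg hc hn hA hdiag
      simp only [hone, Pi.add_apply, Pi.mul_apply, Pi.sub_apply, id_eq, Matrix.mul_one, one_mul,
        sub_self, zero_mul, add_zero]
      linarith)
  have htI : t ∈ Set.Icc (0 : ℝ) 1 := ⟨ht.1, ht.2.le⟩
  refine ⟨t, htI, ?_⟩
  rw [consensusError_eq_right (hdet t htI)]
  exact add_lt_of_neg_right _ (mul_neg_of_pos_of_neg (sub_pos.2 ht.2) hneg)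

lemma inv_one_sub_smul_fromBlocks {n m : Type*} [Fintype n] [DecidableEq n] [Fintype m]
    [DecidableEq m] (A : Matrix n n ℝ) (B : Matrix n m ℝ) {lam : ℝ} (hlam : lam ≠ 0)
    (hdet : IsUnit (1 - (1 - lam) • A).det) :
    lam • (1 - (1 - lam) • (Matrix.fromBlocks A B 0 1 : Matrix (n ⊕ m) (n ⊕ m) ℝ))⁻¹ =
      Matrix.fromBlocks (lam • resolventFJ A lam) ((1 - lam) • (resolventFJ A lam * B)) 0 1 := by
  have hG : (1 - (1 - lam) • A) * resolventFJ A lam = 1 := Matrix.mul_nonsing_inv _ hdet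
  have hinv : (1 - (1 - lam) • (Matrix.fromBlocks A B 0 1 : Matrix (n ⊕ m) (n ⊕ m) ℝ))⁻¹ =
      Matrix.fromBlocks (resolventFJ A lam) ((lam⁻¹ * (1 - lam)) • (resolventFJ A lam * B)) 0 (lam⁻¹ • 1) := by
    refine Matrix.inv_eq_right_inv ?_
    have hK : (1 - (1 - lam) • Matrix.fromBlocks A B 0 1 : Matrix (n ⊕ m) (n ⊕ m) ℝ) =
        Matrix.fromBlocks (1 - (1 - lam) • A) (-((1 - lam) • B)) 0 (lam • 1) := by
      rw [← Matrix.fromBlocks_one, Matrix.fromBlocks_smul, sub_eq_add_neg, Matrix.fromBlocks_neg,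
        Matrix.fromBlocks_add]
      congr 1 <;> module
    rw [hK, Matrix.fromBlocks_multiply, ← Matrix.fromBlocks_one]
    congr 1
    · simp [hG]
    · rw [Matrix.mul_smul, ← Matrix.mul_assoc, hG, Matrix.one_mul, Matrix.mul_smul,
        Matrix.mul_one]
      module
    · simp
    · simp [smul_smul, hlam]
  rw [hinv, Matrix.fromBlocks_smul, smul_smul, smul_smul, ← mul_assoc, mul_inv_cancel₀ hlam]
  simp

lemma trace_one_add_smul_fromBlocks_mul {n m l : Type*} [Fintype n] [DecidableEq n] [Fintype m]
    [DecidableEq m] [Fintype l] (X : Matrix l (n ⊕ m) ℝ) (d : ℝ) :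
    ((1 + d • (Matrix.fromBlocks 0 0 0 1 : Matrix (n ⊕ m) (n ⊕ m) ℝ)) * Xᵀ * X).trace =
      ∑ i, ∑ j, X i (Sum.inl j) ^ 2 + (1 + d) * ∑ i, ∑ k, X i (Sum.inr k) ^ 2 := by
  have hD : (1 + d • (Matrix.fromBlocks 0 0 0 1 : Matrix (n ⊕ m) (n ⊕ m) ℝ)) =
      Matrix.diagonal (Sum.elim (fun _ => 1) fun _ => 1 + d) := by
    rw [← Matrix.fromBlocks_one, Matrix.fromBlocks_smul, Matrix.fromBlocks_add,
      ← Matrix.fromBlocks_diagonal]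
    congr 1
    · simp
    · simp
    · simp
    · ext i j
      by_cases h : i = j <;> simp [h]
  rw [hD, Matrix.mul_assoc, Matrix.trace]
  simp only [Matrix.diag_apply, Matrix.diagonal_mul]
  simp only [Fintype.sum_sum_type, Sum.elim_inl,
    Sum.elim_inr, one_mul, Matrix.mul_apply, Matrix.transpose_apply, ← Finset.mul_sum, ← sq]
  congr 1
  · exact Finset.sum_comm
  · rw [Finset.sum_comm]

/-- In the malicious-agent setup, for every fixed `d ≥ 0` the limit
`ē(0) = lim_{λ→0⁺} e(λ, d)` exists, the extension `ē` of `e(·, d)` to `[0,1]` by this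
value is continuous on `[0,1]`, attains a global minimum there, and every global
minimizer `λ*` satisfies `0 < λ* < 1`: the optimal Friedkin–Johnsen parameter is
neither full collaboration (`λ = 0`) nor full competition (`λ = 1`). -/
theorem optimal_lambda_strictly_interior
    (R M : ℕ) (hR : 2 ≤ R) (hM : 1 ≤ M)
    (W0 : Matrix (Fin R ⊕ Fin M) (Fin R ⊕ Fin M) ℝ)
    (hW0symm : W0.IsSymm)
    (hW0nonneg : ∀ i j, 0 ≤ W0 i j)
    (hW0row : ∀ i, ∑ j, W0 i j = 1)
    (hW0diag : ∀ i, W0 i i = 0)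
    (hW0irr : ∀ i j, ∃ k : ℕ, 0 < (W0 ^ k) i j)
    (W : Matrix (Fin R ⊕ Fin M) (Fin R ⊕ Fin M) ℝ)
    (hW : W = Matrix.fromBlocks W0.toBlocks₁₁ W0.toBlocks₁₂ 0 1)
    (hW12 : W0.toBlocks₁₂ ≠ 0)
    (L : ℝ → Matrix (Fin R ⊕ Fin M) (Fin R ⊕ Fin M) ℝ)
    (hL : ∀ lam : ℝ, L lam = lam • (1 - (1 - lam) • W)⁻¹)
    (S : Matrix (Fin R) (Fin R ⊕ Fin M) ℝ)
    (hS : S = Matrix.of fun i j => if j = Sum.inl i then 1 else 0)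
    (CR : Matrix (Fin R) (Fin R) ℝ)
    (hCR : CR = Matrix.of fun _ _ => (R : ℝ)⁻¹)
    (V : Matrix (Fin R ⊕ Fin M) (Fin R ⊕ Fin M) ℝ)
    (hV : V = Matrix.fromBlocks 0 0 0 1)
    (E : ℝ → Matrix (Fin R) (Fin R ⊕ Fin M) ℝ)
    (hE : ∀ lam : ℝ, E lam = S * L lam - CR * S)
    (e : ℝ → ℝ → ℝ)
    (he : ∀ (lam d : ℝ), e lam d = ((1 + d • V) * (E lam)ᵀ * E lam).trace)
    (d : ℝ) (hd : 0 ≤ d) :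
    ∃ e0 : ℝ,
      Filter.Tendsto (fun lam => e lam d) (nhdsWithin 0 (Set.Ioi 0)) (nhds e0)
      ∧ ∀ ebar : ℝ → ℝ, ebar 0 = e0 →
          (∀ lam ∈ Set.Ioc (0 : ℝ) 1, ebar lam = e lam d) →
          ContinuousOn ebar (Set.Icc 0 1)
          ∧ (∃ lamStar ∈ Set.Icc (0 : ℝ) 1,
              ∀ lam ∈ Set.Icc (0 : ℝ) 1, ebar lamStar ≤ ebar lam)
          ∧ ∀ lamStar ∈ Set.Icc (0 : ℝ) 1,
              (∀ lam ∈ Set.Icc (0 : ℝ) 1, ebar lamStar ≤ ebar lam) →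
              lamStar ∈ Set.Ioo (0 : ℝ) 1 := by
  have : Nonempty (Fin M) := ⟨⟨0, hM⟩⟩
  have hR0 : (R : ℝ) ≠ 0 := by positivity
  set A := W0.toBlocks₁₁
  set B := W0.toBlocks₁₂
  have hA : ∀ i j, 0 ≤ A i j := fun i j => hW0nonneg _ _
  have hB : ∀ i j, 0 ≤ B i j := fun i j => hW0nonneg _ _
  have hmin : ∀ lam ∈ Set.Icc (0 : ℝ) 1, ∀ x : Fin R → ℝ,
      (∀ i, 0 ≤ ((1 - (1 - lam) • A) *ᵥ x) i) → ∀ i, 0 ≤ x i := fun lam hlam x hx =>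
    nonneg_of_superharmonic hW0nonneg hW0row hW0irr (by linarith [hlam.2])
      (by linarith [hlam.1]) hx
  have hdet : ∀ lam ∈ Set.Icc (0 : ℝ) 1, IsUnit (1 - (1 - lam) • A).det :=
    fun lam hlam => isUnit_det_of_minimum_principle (hmin lam hlam)
  have hG : ∀ lam ∈ Set.Icc (0 : ℝ) 1, ∀ i j, 0 ≤ resolventFJ A lam i j :=
    fun lam hlam => inv_nonneg_of_minimum_principle (hmin lam hlam)
  have hc : (R : ℝ)⁻¹ * Fintype.card (Fin R) = 1 := by simp [hR0]
  set f := consensusError A B (R : ℝ)⁻¹ d with hf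
  have hfcont : ContinuousOn f (Set.Icc 0 1) := continuousOn_consensusError hdet _ _
  have hef : ∀ lam ∈ Set.Ioc (0 : ℝ) 1, e lam d = f lam := by
    intro lam hlam
    have hSX : ∀ (X : Matrix (Fin R ⊕ Fin M) (Fin R ⊕ Fin M) ℝ) i j,
        (S * X) i j = X (Sum.inl i) j := fun X i j => by simp [hS, Matrix.mul_apply]
    have hCS : ∀ i j, (CR * S) i (Sum.inl j) = (R : ℝ)⁻¹ := fun i j => by
      simp [hS, hCR, Matrix.mul_apply]
    have hCS' : ∀ i k, (CR * S) i (Sum.inr k) = 0 := fun i k => by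
      simp [hS, hCR, Matrix.mul_apply]
    rw [he, hV, trace_one_add_smul_fromBlocks_mul]
    simp only [hE, Matrix.sub_apply, hSX, hCS, hCS', hL, hW,
      inv_one_sub_smul_fromBlocks A B hlam.1.ne' (hdet lam ⟨hlam.1.le, hlam.2⟩)]
    simp [hf, consensusError]
  have hleft := exists_consensusError_lt_left hc hd hA hB hdet hG
  have hright := exists_consensusError_lt_right (B := B) (d := d) hc (by simpa using hR) hA
    (fun i => hW0diag _) hdet
  refine ⟨f 0, ?_, fun ebar h0 hbar => ?_⟩
  · have h : Filter.Tendsto f (nhdsWithin 0 (Set.Ioc 0 1)) (nhds (f 0)) :=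
      (hfcont 0 (by simp)).mono_left (nhdsWithin_mono _ Set.Ioc_subset_Icc_self)
    have h' := h.congr' (Filter.eventually_of_mem self_mem_nhdsWithin fun t ht => (hef t ht).symm)
    rwa [nhdsWithin_Ioc_eq_nhdsGT one_pos] at h'
  · have heq : Set.EqOn ebar f (Set.Icc 0 1) := by
      intro t ht
      rcases ht.1.eq_or_lt with h | h
      · rw [← h, h0]
      · rw [hbar t ⟨h, ht.2⟩, hef t ⟨h, ht.2⟩]
    have hcont : ContinuousOn ebar (Set.Icc 0 1) := hfcont.congr heq
    refine ⟨hcont, isCompact_Icc.exists_isMinOn (by simp) hcont, fun s hs hsmin => ?_⟩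
    have hfmin : ∀ t ∈ Set.Icc (0 : ℝ) 1, f s ≤ f t := fun t ht => by
      simpa only [heq hs, heq ht] using hsmin t ht
    refine ⟨hs.1.lt_of_ne ?_, hs.2.lt_of_ne ?_⟩
    · rintro rfl
      obtain ⟨t, ht, hlt⟩ := hleft
      exact (hfmin t ht).not_gt hlt
    · rintro rfl
      obtain ⟨t, ht, hlt⟩ := hright
      exact (hfmin t ht).not_gt hlt
end
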